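/- Let $k$ be a field of characteristic $p > 2$, and let $H_n$ be the $T$-space of $k_0\langle X\rangle$ generated by $x_1^p x_2^p \cdots x_n^p$. Then for every $m \geq 1$, $H_{2m+1} \subseteq H_1 + H_{m+1}$. -/

import Mathlib

open scoped BigOperators

/-- The free non-unital associative algebra over `k` on countably many variables,
realized as the semigroup algebra of the free semigroup on `ℕ`. -/
abbrev FA (k : Type*) [Field k] := MonoidAlgebra k (FreeSemigroup ℕ)

/-- The generator (variable) `x_i`. -/
noncomputable def Xg (k : Type*) [Field k] (i : ℕ) : FA k :=
  MonoidAlgebra.single (FreeSemigroup.of i) 1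

/-- Product of a (nonempty) list in a non-unital semiring; `0` on the empty list. -/
def lprod {A : Type*} [NonUnitalSemiring A] : List A → A
  | [] => 0
  | [a] => a
  | a :: b :: l => a * lprod (b :: l)

/-- `n`-th power in a non-unital semiring (zero for `n = 0`). -/
def npow' {A : Type*} [NonUnitalSemiring A] (a : A) (n : ℕ) : A :=
  lprod (List.replicate n a)

/-- The full multilinear symmetrization `S^{(d)}(y_1,…,y_d) = ∑_{σ ∈ Σ_d} y_{σ(1)} ⋯ y_{σ(d)}`. -/
def Ssym {A : Type*} [NonUnitalSemiring A] (d : ℕ) (y : Fin d → A) : A :=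
  ∑ σ : Equiv.Perm (Fin d), lprod (List.ofFn (fun i => y (σ i)))

/-- A T-space: a subspace closed under all substitution endomorphisms
(non-unital algebra endomorphisms). -/
def IsTSpace (k : Type*) [Field k] (V : Submodule k (FA k)) : Prop :=
  ∀ (φ : FA k →ₙₐ[k] FA k), ∀ v ∈ V, φ v ∈ V

/-- The T-space generated by a set `S`: the span of all substitution instances
of elements of `S`. -/
noncomputable def TSpan (k : Type*) [Field k] (S : Set (FA k)) : Submodule k (FA k) :=
  Submodule.span k {a | ∃ (φ : FA k →ₙₐ[k] FA k) (s : FA k), s ∈ S ∧ a = φ s}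

/-- The set of products `u * v` with `u ∈ U`, `v ∈ V`. -/
def mulSet {k : Type*} [Field k] (U V : Submodule k (FA k)) : Set (FA k) :=
  {a | ∃ u ∈ U, ∃ v ∈ V, a = u * v}

/-- The T-spaces `S_n^{(d)}`: `S_1^{(d)}` is generated by `S^{(d)}(x_1,…,x_d)` and
`S_{n+1}^{(d)} = (S_n^{(d)} S_1^{(d)})^S`. -/
noncomputable def Sn (k : Type*) [Field k] (d : ℕ) : ℕ → Submodule k (FA k)
  | 0 => ⊥
  | 1 => TSpan k {Ssym d (fun i => Xg k i)}
  | (n+2) => TSpan k (mulSet (Sn k d (n+1)) (Sn k d 1))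

/-- The T-spaces `H_n`: `H_1` is generated by `x_1^p` and `H_{n+1} = (H_n H_1)^S`. -/
noncomputable def Hn (k : Type*) [Field k] (p : ℕ) : ℕ → Submodule k (FA k)
  | 0 => ⊥
  | 1 => TSpan k {npow' (Xg k 0) p}
  | (n+2) => TSpan k (mulSet (Hn k p (n+1)) (Hn k p 1))

/-- The word `x_1^p x_2^p ⋯ x_n^p`. -/
noncomputable def hword (k : Type*) [Field k] (p n : ℕ) : FA k :=
  lprod ((List.range n).map (fun t => npow' (Xg k t) p))

/-- The sum of all words of length `n` in the letters `a i`, `i ∈ s`, without repeated index. -/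
def symSum {ι B : Type*} [DecidableEq ι] [Ring B] (a : ι → B) : ℕ → Finset ι → B
  | 0, _ => 1
  | n + 1, s => ∑ i ∈ s, a i * symSum a n (s.erase i)

/-- The sum of all words of length `n` in the letters `a i`, `i ∈ s`, in which every index of `s`
occurs. -/
def surjSum {ι B : Type*} [DecidableEq ι] [Ring B] (a : ι → B) : ℕ → Finset ι → B
  | 0, s => if s = ∅ then 1 else 0
  | n + 1, s => ∑ i ∈ s, a i * (surjSum a n s + surjSum a n (s.erase i))

/-- The sum of all words of length `n` in two letters `x`, `y` in which `x` occurs `i` times. -/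
def wordSum {B : Type*} [Ring B] (x y : B) : ℕ → ℕ → B
  | 0, 0 => 1
  | 0, _ + 1 => 0
  | n + 1, 0 => y * wordSum x y n 0
  | n + 1, i + 1 => x * wordSum x y n i + y * wordSum x y n (i + 1)

section Words

variable {ι κ B : Type*} [DecidableEq ι] [DecidableEq κ] [Ring B]

theorem symSum_congr {a b : ι → B} (n : ℕ) {s : Finset ι} (h : ∀ i ∈ s, a i = b i) :
    symSum a n s = symSum b n s := by
  induction n generalizing s with
  | zero => rfl
  | succ n ih =>
    refine Finset.sum_congr rfl fun i hi => ?_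
    rw [h i hi, ih fun l hl => h l (Finset.mem_of_mem_erase hl)]

theorem symSum_map (a : κ → B) (e : ι ↪ κ) (n : ℕ) (s : Finset ι) :
    symSum a n (s.map e) = symSum (a ∘ e) n s := by
  induction n generalizing s with
  | zero => rfl
  | succ n ih =>
    simp only [symSum, Finset.sum_map, ← Finset.map_erase, ih, Function.comp]

theorem symSum_add (a : ι → B) (m n : ℕ) (s : Finset ι) :
    ∑ I ∈ s.powersetCard m, symSum a m I * symSum a n (s \ I) = symSum a (m + n) s := by
  induction m generalizing s with
  | zero => simp [symSum]
  | succ m ih =>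
    rw [Nat.add_right_comm]
    simp only [symSum, Finset.sum_mul, ← ih, Finset.mul_sum]
    rw [Finset.sum_sigma', Finset.sum_sigma']
    refine Finset.sum_bij' (fun x _ => ⟨x.2, x.1.erase x.2⟩) (fun x _ => ⟨insert x.1 x.2, x.1⟩)
      ?_ ?_ ?_ ?_ ?_
    · rintro ⟨I, i⟩ h
      simp only [Finset.mem_sigma, Finset.mem_powersetCard] at h ⊢
      obtain ⟨⟨h1, h2⟩, h3⟩ := h
      exact ⟨h1 h3, Finset.erase_subset_erase _ h1, by rw [Finset.card_erase_of_mem h3, h2]; rfl⟩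
    · rintro ⟨i, I⟩ h
      simp only [Finset.mem_sigma, Finset.mem_powersetCard] at h ⊢
      obtain ⟨h1, h2, h3⟩ := h
      refine ⟨⟨Finset.insert_subset h1 (h2.trans (Finset.erase_subset _ _)), ?_⟩,
        Finset.mem_insert_self _ _⟩
      rw [Finset.card_insert_of_notMem fun h => Finset.notMem_erase i s (h2 h), h3]
    · rintro ⟨I, i⟩ h
      simp only [Finset.mem_sigma] at h
      simp [Finset.insert_erase h.2]
    · rintro ⟨i, I⟩ h
      simp only [Finset.mem_sigma, Finset.mem_powersetCard] at h
      simp [Finset.erase_insert fun h' => Finset.notMem_erase i s (h.2.1 h')]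
    · rintro ⟨I, i⟩ h
      simp only [Finset.mem_sigma] at h
      have : s \ I = s.erase i \ I.erase i := by
        ext l
        simp only [Finset.mem_sdiff, Finset.mem_erase]
        by_cases hl : l = i
        · subst hl; simp [h.2]
        · simp [hl]
      rw [this, mul_assoc]

theorem symSum_insert (a : ι → B) {j : ι} {n : ℕ} {s : Finset ι} (hs : s.card = n) (hj : j ∉ s) :
    symSum a (n + 1) (insert j s) =
      a j * symSum a n s + ∑ i ∈ s, symSum (Function.update a i (a i * a j)) n s := by
  induction n generalizing s with
  | zero => simp [Finset.card_eq_zero.mp hs, symSum]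
  | succ n ih =>
    rw [symSum, Finset.sum_insert hj, Finset.erase_insert hj]
    congr 1
    simp only [symSum.eq_2]
    rw [Finset.sum_comm]
    refine Finset.sum_congr rfl fun i hi => ?_
    have hij : j ≠ i := fun h => hj (h ▸ hi)
    rw [Finset.erase_insert_of_ne hij, ← symSum.eq_2,
      ih (by rw [Finset.card_erase_of_mem hi, hs]; rfl)
      (fun h => hj (Finset.mem_of_mem_erase h)), mul_add, ← Finset.add_sum_erase _ _ hi,
      Finset.mul_sum]
    congr 1
    · rw [Function.update_self, mul_assoc]
      congr 2
      refine symSum_congr n fun l hl => ?_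
      rw [Function.update_of_ne (Finset.ne_of_mem_erase hl)]
    · refine Finset.sum_congr rfl fun l hl => ?_
      rw [Function.update_of_ne (Finset.ne_of_mem_erase hl).symm]

theorem surjSum_eq_zero (a : ι → B) {n : ℕ} {s : Finset ι} (h : n < s.card) :
    surjSum a n s = 0 := by
  induction n generalizing s with
  | zero => simp [surjSum, Finset.card_pos.mp h |>.ne_empty]
  | succ n ih =>
    refine Finset.sum_eq_zero fun i hi => ?_
    rw [ih (by omega), ih (by rw [Finset.card_erase_of_mem hi]; omega), add_zero, mul_zero]

theorem surjSum_card (a : ι → B) {n : ℕ} {s : Finset ι} (h : s.card = n) :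
    surjSum a n s = symSum a n s := by
  induction n generalizing s with
  | zero => simp [surjSum, symSum, Finset.card_eq_zero.mp h]
  | succ n ih =>
    refine Finset.sum_congr rfl fun i hi => ?_
    rw [surjSum_eq_zero a (by omega), ih (by rw [Finset.card_erase_of_mem hi]; omega), zero_add]

theorem sum_powerset_surjSum (a : ι → B) (n : ℕ) (s : Finset ι) :
    ∑ J ∈ s.powerset, surjSum a n J = (∑ i ∈ s, a i) ^ n := by
  induction n with
  | zero => simp [surjSum, Finset.sum_ite_eq']
  | succ n ih =>
    rw [pow_succ', ← ih, Finset.sum_mul]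
    have h : ∀ J ∈ s.powerset, surjSum a (n + 1) J =
        ∑ i ∈ s, if i ∈ J then a i * (surjSum a n J + surjSum a n (J.erase i)) else 0 := by
      intro J hJ
      rw [← Finset.sum_filter, Finset.filter_mem_eq_inter,
        Finset.inter_eq_right.mpr (Finset.mem_powerset.mp hJ)]
      rfl
    rw [Finset.sum_congr rfl h, Finset.sum_comm]
    refine Finset.sum_congr rfl fun i hi => ?_
    obtain ⟨t, hit, rfl⟩ : ∃ t, i ∉ t ∧ s = insert i t :=
      ⟨s.erase i, Finset.notMem_erase _ _, (Finset.insert_erase hi).symm⟩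
    rw [Finset.sum_powerset_insert hit, Finset.sum_powerset_insert hit, Finset.sum_eq_zero,
      zero_add, ← Finset.sum_add_distrib, Finset.mul_sum]
    · refine Finset.sum_congr rfl fun J hJ => ?_
      have hJ : i ∉ J := fun h => hit (Finset.mem_powerset.mp hJ h)
      rw [if_pos (Finset.mem_insert_self _ _), Finset.erase_insert hJ, add_comm (surjSum a n J)]
    · intro J hJ
      rw [if_neg fun h => hit (Finset.mem_powerset.mp hJ h)]

theorem wordSum_eq_zero (x y : B) {n i : ℕ} (h : n < i) : wordSum x y n i = 0 := by
  induction n generalizing i with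
  | zero => obtain ⟨i, rfl⟩ := Nat.exists_eq_succ_of_ne_zero h.ne'; rfl
  | succ n ih =>
    obtain ⟨i, rfl⟩ := Nat.exists_eq_succ_of_ne_zero (by omega : i ≠ 0)
    rw [Nat.succ_eq_add_one, wordSum, ih (by omega), ih (by omega), mul_zero, mul_zero, add_zero]

theorem wordSum_zero (x y : B) (n : ℕ) : wordSum x y n 0 = y ^ n := by
  induction n with
  | zero => simp [wordSum]
  | succ n ih => rw [wordSum, ih, pow_succ']

theorem wordSum_self (x y : B) (n : ℕ) : wordSum x y n n = x ^ n := by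
  induction n with
  | zero => simp [wordSum]
  | succ n ih => rw [wordSum, ih, wordSum_eq_zero x y n.lt_succ_self, mul_zero, add_zero, pow_succ']

theorem sum_wordSum (x y : B) (n : ℕ) :
    ∑ i ∈ Finset.range (n + 1), wordSum x y n i = (x + y) ^ n := by
  induction n with
  | zero => simp [wordSum]
  | succ n ih =>
    rw [Finset.sum_range_succ', pow_succ', ← ih, add_mul, Finset.mul_sum, Finset.mul_sum]
    simp only [wordSum, Finset.sum_add_distrib]
    rw [add_assoc, ← Finset.sum_range_succ' (fun i => y * wordSum x y n i),
      Finset.sum_range_succ _ (n + 1), wordSum_eq_zero x y n.lt_succ_self, mul_zero, add_zero]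

theorem wordSum_commutator (x w : B) (n : ℕ) :
    wordSum x (x * w - w * x) (n + 1) n = x ^ (n + 1) * w - w * x ^ (n + 1) := by
  induction n with
  | zero => simp [wordSum]
  | succ n ih =>
    rw [wordSum, ih, wordSum_self]
    simp only [pow_succ' x (n + 1)]
    noncomm_ring

theorem symSum_ite (x y : B) (I : Finset ι) {n : ℕ} {s : Finset ι} (hs : s.card = n) :
    symSum (fun i => if i ∈ I then x else y) n s =
      ((s ∩ I).card.factorial * (s \ I).card.factorial) • wordSum x y n (s ∩ I).card := by
  induction n generalizing s with
  | zero => simp [Finset.card_eq_zero.mp hs, symSum, wordSum]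
  | succ n ih =>
    have hx : ∀ i ∈ s ∩ I, (if i ∈ I then x else y) *
        symSum (fun i => if i ∈ I then x else y) n (s.erase i) =
        (((s ∩ I).card - 1).factorial * (s \ I).card.factorial) •
          (x * wordSum x y n ((s ∩ I).card - 1)) := by
      intro i hi
      obtain ⟨h1, h2⟩ := Finset.mem_inter.mp hi
      rw [if_pos h2, ih (by rw [Finset.card_erase_of_mem h1]; omega), Finset.erase_inter,
        Finset.card_erase_of_mem hi, Finset.erase_sdiff_comm, Finset.erase_eq_of_notMem
        (s := s \ I) (by simp [h2]), mul_smul_comm]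
    have hy : ∀ i ∈ s \ I, (if i ∈ I then x else y) *
        symSum (fun i => if i ∈ I then x else y) n (s.erase i) =
        ((s ∩ I).card.factorial * ((s \ I).card - 1).factorial) •
          (y * wordSum x y n (s ∩ I).card) := by
      intro i hi
      obtain ⟨h1, h2⟩ := Finset.mem_sdiff.mp hi
      rw [if_neg h2, ih (by rw [Finset.card_erase_of_mem h1]; omega), Finset.erase_inter,
        Finset.erase_sdiff_comm, Finset.card_erase_of_mem hi, Finset.erase_eq_of_notMem
        (s := s ∩ I) (by simp [h2]), mul_smul_comm]
    rw [symSum, ← Finset.sum_inter_add_sum_sdiff s I, Finset.sum_congr rfl hx,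
      Finset.sum_congr rfl hy, Finset.sum_const, Finset.sum_const, smul_smul, smul_smul]
    have hc := Finset.card_inter_add_card_sdiff s I
    rw [hs] at hc
    generalize (s ∩ I).card = i at *
    generalize (s \ I).card = j at *
    rcases i with _ | i
    · rcases j with _ | j
      · omega
      · simp [wordSum, Nat.factorial_succ]
    · rcases j with _ | j
      · rw [wordSum, wordSum_eq_zero x y (by omega : n < i + 1)]
        simp [Nat.factorial_succ]
      · simp only [wordSum, Nat.factorial_succ, Nat.add_sub_cancel, smul_add]
        congr 2 <;> ring

end Words

section Spans

variable {ι B : Type*} [DecidableEq ι] [Ring B]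

/-- The linear span of the `n`-th powers of the elements of `A`. -/
def powSpan (k : Type*) [Field k] [Algebra k B] (A : Ideal B) (n : ℕ) : Submodule k B :=
  Submodule.span k ((· ^ n) '' (A : Set B))

/-- The linear span of the full symmetrizations of degree `n` of elements of `A`. -/
def symSpan (k : Type*) [Field k] [Algebra k B] (A : Ideal B) (n : ℕ) : Submodule k B :=
  Submodule.span k {x | ∃ a : Fin n → B, (∀ i, a i ∈ A) ∧ symSum a n Finset.univ = x}

variable {k : Type*} [Field k] [Algebra k B] {A : Ideal B} {p : ℕ}

theorem pow_mem_powSpan {x : B} (hx : x ∈ A) (n : ℕ) : x ^ n ∈ powSpan k A n :=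
  Submodule.subset_span ⟨x, hx, rfl⟩

theorem symSum_mem_symSpan {a : ι → B} {n : ℕ} {s : Finset ι} (hs : s.card = n)
    (ha : ∀ i ∈ s, a i ∈ A) : symSum a n s ∈ symSpan k A n := by
  let e : Fin n ↪ ι := (s.equivFinOfCardEq hs).symm.toEmbedding.trans (Function.Embedding.subtype _)
  have he : Finset.univ.map e = s := by
    ext i
    simp only [Finset.mem_map, Finset.mem_univ, true_and]
    constructor
    · rintro ⟨j, rfl⟩
      exact ((s.equivFinOfCardEq hs).symm j).2
    · intro hi
      exact ⟨s.equivFinOfCardEq hs ⟨i, hi⟩, by simp [e]⟩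
  rw [← he, symSum_map]
  exact Submodule.subset_span ⟨a ∘ e, fun i => ha _ ((s.equivFinOfCardEq hs).symm i).2, rfl⟩

theorem surjSum_mem_powSpan {a : ι → B} (n : ℕ) {s : Finset ι} (ha : ∀ i ∈ s, a i ∈ A) :
    surjSum a n s ∈ powSpan k A n := by
  induction s using Finset.strongInduction with
  | H s ih =>
    have h := sum_powerset_surjSum a n s
    rw [← Finset.add_sum_erase _ _ (Finset.mem_powerset_self s)] at h
    rw [eq_sub_of_add_eq h]
    refine Submodule.sub_mem _ (pow_mem_powSpan (Submodule.sum_mem _ ha) n)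
      (Submodule.sum_mem _ fun J hJ => ?_)
    obtain ⟨h1, h2⟩ := Finset.mem_erase.mp hJ
    have hJs := Finset.mem_powerset.mp h2
    exact ih J (hJs.ssubset_of_ne h1) fun i hi => ha i (hJs hi)

theorem symSum_mem_powSpan {a : ι → B} {n : ℕ} {s : Finset ι} (hs : s.card = n)
    (ha : ∀ i ∈ s, a i ∈ A) : symSum a n s ∈ powSpan k A n :=
  surjSum_card a hs ▸ surjSum_mem_powSpan n ha

theorem symSpan_le_powSpan (n : ℕ) : symSpan k A n ≤ powSpan k A n := by
  refine Submodule.span_le.mpr ?_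
  rintro _ ⟨a, ha, rfl⟩
  exact symSum_mem_powSpan (by simp) fun i _ => ha i

theorem powSpan_add_self_le (n : ℕ) : powSpan k A (n + n) ≤ powSpan k A n := by
  refine Submodule.span_le.mpr ?_
  rintro _ ⟨x, hx, rfl⟩
  have := pow_mem_powSpan (k := k) (A.mul_mem_left x hx) n
  rwa [← pow_two, ← pow_mul, two_mul] at this

theorem mem_of_mem_powSpan {n : ℕ} (hn : n ≠ 0) {h : B} (hh : h ∈ powSpan k A n) : h ∈ A := by
  have : powSpan k A n ≤ A.restrictScalars k := by
    refine Submodule.span_le.mpr ?_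
    rintro _ ⟨x, hx, rfl⟩
    exact A.pow_mem_of_mem hx n (Nat.pos_of_ne_zero hn)
  exact this hh

section Prime

variable [CharP k p]

theorem wordSum_mem_symSpan (hp : p.Prime) {x y : B} (hx : x ∈ A) (hy : y ∈ A) {i : ℕ}
    (h0 : 0 < i) (hi : i < p) : wordSum x y p i ∈ symSpan k A p := by
  have h := symSum_ite x y (Finset.range i) (Finset.card_range p)
  have h1 : Finset.range p ∩ Finset.range i = Finset.range i :=
    Finset.inter_eq_right.mpr (Finset.range_subset_range.mpr hi.le)
  have h2 := Finset.card_sdiff_of_subset (Finset.range_subset_range.mpr hi.le)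
  rw [h1, h2, Finset.card_range, Finset.card_range, ← Nat.cast_smul_eq_nsmul k] at h
  have hne : ((i.factorial * (p - i).factorial : ℕ) : k) ≠ 0 := by
    rw [Ne, CharP.cast_eq_zero_iff k p, hp.dvd_mul, hp.dvd_factorial, hp.dvd_factorial]
    omega
  rw [← inv_smul_eq_iff₀ hne] at h
  rw [← h]
  refine Submodule.smul_mem _ _ (symSum_mem_symSpan (Finset.card_range p) fun l _ => ?_)
  split_ifs <;> assumption

theorem add_pow_sub_mem_symSpan (hp : p.Prime) {x y : B} (hx : x ∈ A) (hy : y ∈ A) :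
    (x + y) ^ p - (x ^ p + y ^ p) ∈ symSpan k A p := by
  obtain ⟨q, rfl⟩ := Nat.exists_eq_succ_of_ne_zero hp.ne_zero
  rw [Nat.succ_eq_add_one, ← sum_wordSum, Finset.sum_range_succ, Finset.sum_range_succ',
    wordSum_self, wordSum_zero, add_assoc, add_comm (y ^ _), add_sub_cancel_right]
  refine Submodule.sum_mem _ fun i hi => wordSum_mem_symSpan hp hx hy i.succ_pos ?_
  have := Finset.mem_range.mp hi
  omega

variable [A.IsTwoSided]

theorem commutator_mem_symSpan (hp : p.Prime) {h : B} (hh : h ∈ powSpan k A p) (w : B) :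
    h * w - w * h ∈ symSpan k A p := by
  induction hh using Submodule.span_induction with
  | mem x hx =>
    obtain ⟨x, hx, rfl⟩ := hx
    obtain ⟨q, rfl⟩ := Nat.exists_eq_succ_of_ne_zero hp.ne_zero
    dsimp only
    rw [Nat.succ_eq_add_one, ← wordSum_commutator]
    refine wordSum_mem_symSpan hp hx ?_ (Nat.pos_of_ne_zero ?_) q.lt_succ_self
    · exact A.sub_mem (A.mul_mem_right w hx) (A.mul_mem_left w hx)
    · rintro rfl
      exact Nat.not_prime_one hp
  | zero => simp
  | add x y _ _ h1 h2 =>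
    convert Submodule.add_mem _ h1 h2 using 1
    noncomm_ring
  | smul c x _ h1 =>
    rw [smul_mul_assoc, mul_smul_comm, ← smul_sub]
    exact Submodule.smul_mem _ c h1

theorem commutator_mem_powSpan (hp : p.Prime) {h : B} (hh : h ∈ powSpan k A p) (w : B) :
    h * w - w * h ∈ powSpan k A p :=
  symSpan_le_powSpan p (commutator_mem_symSpan hp hh w)

theorem commutator_mem_powSpan_pow (hp : p.Prime) {n : ℕ} {h : B} (hh : h ∈ powSpan k A p ^ n)
    (w : B) : h * w - w * h ∈ powSpan k A p ^ n := by
  induction n generalizing h with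
  | zero =>
    obtain ⟨c, rfl⟩ := Submodule.mem_one.mp (pow_zero (powSpan k A p) ▸ hh)
    rw [Algebra.commutes, sub_self]
    exact Submodule.zero_mem _
  | succ n ih =>
    rw [pow_succ] at hh ⊢
    induction hh using Submodule.mul_induction_on' with
    | mem_mul_mem x hx y hy =>
      have h : x * y * w - w * (x * y) = x * (y * w - w * y) + (x * w - w * x) * y := by
        noncomm_ring
      rw [h]
      exact Submodule.add_mem _ (Submodule.mul_mem_mul hx (commutator_mem_powSpan hp hy w))
        (Submodule.mul_mem_mul (ih hx) hy)
    | add x _ y _ h1 h2 =>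
      convert Submodule.add_mem _ h1 h2 using 1
      noncomm_ring

theorem commutator_of_mem_pow_mem_powSpan (hp : p.Prime) {n : ℕ} {h : B}
    (hh : h ∈ powSpan k A p ^ n) (w : B) : h * w - w * h ∈ powSpan k A p := by
  induction n generalizing h w with
  | zero =>
    obtain ⟨c, rfl⟩ := Submodule.mem_one.mp (pow_zero (powSpan k A p) ▸ hh)
    rw [Algebra.commutes, sub_self]
    exact Submodule.zero_mem _
  | succ n ih =>
    rw [pow_succ] at hh
    induction hh using Submodule.mul_induction_on' with
    | mem_mul_mem x hx y hy =>
      have h : x * y * w - w * (x * y) = (x * (y * w) - y * w * x) +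
          (y * (w * x) - w * x * y) := by
        noncomm_ring
      rw [h]
      exact Submodule.add_mem _ (ih hx _) (commutator_mem_powSpan hp hy _)
    | add x _ y _ h1 h2 =>
      convert Submodule.add_mem _ h1 h2 using 1
      noncomm_ring

theorem powSpan_mul_self_le (hp : p.Prime) (hp2 : 2 < p) :
    powSpan k A p * powSpan k A p ≤ powSpan k A p ⊔ symSpan k A p * powSpan k A p := by
  set V := powSpan k A p ⊔ symSpan k A p * powSpan k A p with hV
  have hH : powSpan k A p ≤ V := le_sup_left
  have hUH : symSpan k A p * powSpan k A p ≤ V := le_sup_right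
  have hc {h : B} (hh : h ∈ powSpan k A p) (w : B) : h * w - w * h ∈ V :=
    hH (commutator_mem_powSpan hp hh w)
  conv_lhs => rw [powSpan, Submodule.span_mul_span]
  refine Submodule.span_le.mpr ?_
  rintro _ ⟨_, ⟨x, hx, rfl⟩, _, ⟨y, hy, rfl⟩, rfl⟩
  have hxp := pow_mem_powSpan (k := k) hx p
  have hyp := pow_mem_powSpan (k := k) hy p
  have hsq {z : B} (hz : z ∈ A) : z ^ p * z ^ p ∈ V := by
    rw [← pow_add]
    exact hH (powSpan_add_self_le p (pow_mem_powSpan hz _))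
  obtain ⟨u, hu, hxy⟩ : ∃ u ∈ symSpan k A p, (x + y) ^ p = x ^ p + y ^ p + u :=
    ⟨_, add_pow_sub_mem_symSpan hp hx hy, (add_sub_cancel _ _).symm⟩
  have hxy2 := hsq (A.add_mem hx hy)
  have hu' := symSpan_le_powSpan p hu
  have h2 : (2 : k) • (x ^ p * y ^ p) ∈ V := by
    have h : (2 : k) • (x ^ p * y ^ p) = (x + y) ^ p * (x + y) ^ p - x ^ p * x ^ p - y ^ p * y ^ p
        - (y ^ p * x ^ p - x ^ p * y ^ p) - u * u - u * (x ^ p + y ^ p) - u * (x ^ p + y ^ p)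
        + (u * (x ^ p + y ^ p) - (x ^ p + y ^ p) * u) := by
      rw [hxy, two_smul]
      noncomm_ring
    rw [h]
    have huh : u * (x ^ p + y ^ p) ∈ V :=
      hUH (Submodule.mul_mem_mul hu (Submodule.add_mem _ hxp hyp))
    exact Submodule.add_mem _ (Submodule.sub_mem _ (Submodule.sub_mem _ (Submodule.sub_mem _
      (Submodule.sub_mem _ (Submodule.sub_mem _ (Submodule.sub_mem _ hxy2 (hsq hx)) (hsq hy))
      (hc hyp _)) (hUH (Submodule.mul_mem_mul hu hu'))) huh) huh) (hc hu' _)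
  have hne : (2 : k) ≠ 0 := by
    have : ((2 : ℕ) : k) ≠ 0 := by
      rw [Ne, CharP.cast_eq_zero_iff k p]
      exact Nat.not_dvd_of_pos_of_lt two_pos hp2
    exact_mod_cast this
  exact (Submodule.smul_mem_iff _ hne).mp h2

theorem powSpan_pow_succ_le (hp : p.Prime) (hp2 : 2 < p) {n : ℕ} (hn : 1 ≤ n) :
    powSpan k A p ^ (n + 1) ≤ powSpan k A p ^ n ⊔ symSpan k A p ^ n * powSpan k A p := by
  induction n, hn using Nat.le_induction with
  | base => simpa [pow_two] using powSpan_mul_self_le hp hp2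
  | succ n hn ih =>
    calc powSpan k A p ^ (n + 1 + 1)
        = powSpan k A p * powSpan k A p * powSpan k A p ^ n := by
          rw [pow_succ', pow_succ', mul_assoc]
      _ ≤ (powSpan k A p ⊔ symSpan k A p * powSpan k A p) * powSpan k A p ^ n :=
          mul_le_mul_left (powSpan_mul_self_le hp hp2) _
      _ = powSpan k A p ^ (n + 1) ⊔ symSpan k A p * powSpan k A p ^ (n + 1) := by
          rw [Submodule.sup_mul, mul_assoc, ← pow_succ']
      _ ≤ powSpan k A p ^ (n + 1) ⊔
            symSpan k A p * (powSpan k A p ^ n ⊔ symSpan k A p ^ n * powSpan k A p) :=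
          sup_le_sup_left (mul_le_mul_right ih _) _
      _ = powSpan k A p ^ (n + 1) ⊔ (symSpan k A p * powSpan k A p ^ n ⊔
            symSpan k A p ^ (n + 1) * powSpan k A p) := by
          rw [Submodule.mul_sup, ← mul_assoc, ← pow_succ']
      _ ≤ _ := by
          rw [← sup_assoc]
          refine sup_le_sup_right (sup_le le_rfl ?_) _
          rw [pow_succ']
          exact mul_le_mul_left (symSpan_le_powSpan p) _

theorem symSum_mul_sub_mem_symSpan (hp : p.Prime) {a : ι → B} {i : ι} {s : Finset ι}
    (hs : s.card = p) (hi : i ∉ s) (ha : ∀ l ∈ insert i s, a l ∈ A) :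
    symSum a (p + 1) (insert i s) - symSum a p s * a i ∈ symSpan k A p := by
  have has : ∀ l ∈ s, a l ∈ A := fun l hl => ha l (Finset.mem_insert_of_mem hl)
  rw [symSum_insert a hs hi, add_sub_right_comm, ← neg_sub (symSum a p s * a i)]
  refine Submodule.add_mem _ (Submodule.neg_mem _ (commutator_mem_symSpan hp
    (symSum_mem_powSpan hs has) _)) (Submodule.sum_mem _ fun j hj =>
    symSum_mem_symSpan hs fun l hl => ?_)
  rcases eq_or_ne l j with rfl | hlj
  · rw [Function.update_self]
    exact A.mul_mem_right _ (has l hl)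
  · rw [Function.update_of_ne hlj]
    exact has l hl

theorem symSum_swap_mem_symSpan (hp : p.Prime) {a : ι → B} {x y : ι} {K : Finset ι}
    (hK : K.card + 1 = p) (hx : x ∉ K) (hy : y ∉ K) (hxy : x ≠ y) (ha : ∀ l, a l ∈ A) :
    symSum a p (insert x K) * a y - symSum a p (insert y K) * a x ∈ symSpan k A p := by
  have h1 := symSum_mul_sub_mem_symSpan (k := k) (A := A) hp (a := a) (i := y)
    (s := insert x K) (by rw [Finset.card_insert_of_notMem hx, hK]) (by simp [hxy.symm, hy])
    fun l _ => ha l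
  have h2 := symSum_mul_sub_mem_symSpan (k := k) (A := A) hp (a := a) (i := x)
    (s := insert y K) (by rw [Finset.card_insert_of_notMem hy, hK]) (by simp [hxy, hx])
    fun l _ => ha l
  rw [Finset.insert_comm] at h2
  simpa using Submodule.sub_mem _ h2 h1

theorem rotate_mem (hp : p.Prime) {r : ℕ} {ρ s s' c : B} (hρ : ρ ∈ powSpan k A p ^ r)
    (hs : s ∈ powSpan k A p) (hs' : s' ∈ powSpan k A p) :
    ρ * s * s' * c - s' * ρ * s * c ∈ powSpan k A p ⊔ powSpan k A p ^ (r + 2) := by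
  have hρs : ρ * s ∈ powSpan k A p ^ (r + 1) := by
    rw [pow_succ]
    exact Submodule.mul_mem_mul hρ hs
  have h : ρ * s * s' * c - s' * ρ * s * c =
      (ρ * s * (s' * c) - s' * c * (ρ * s)) + -(s' * (ρ * s * c - c * (ρ * s))) := by
    noncomm_ring
  rw [h]
  refine Submodule.add_mem_sup (commutator_of_mem_pow_mem_powSpan hp hρs _)
    (Submodule.neg_mem _ ?_)
  rw [pow_succ']
  exact Submodule.mul_mem_mul hs' (commutator_mem_powSpan_pow hp hρs c)

theorem swap_right_mem (hp : p.Prime) {r : ℕ} {ρ s : B} (hρ : ρ ∈ powSpan k A p ^ r)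
    (hs : s ∈ powSpan k A p) {a : ι → B} {x y : ι} {K : Finset ι}
    (hK : K.card + 1 = p) (hx : x ∉ K) (hy : y ∉ K) (hxy : x ≠ y) (ha : ∀ l, a l ∈ A) :
    ρ * s * symSum a p (insert x K) * a y - ρ * s * symSum a p (insert y K) * a x ∈
      powSpan k A p ⊔ powSpan k A p ^ (r + 2) := by
  have h := Submodule.mul_mem_mul (Submodule.mul_mem_mul hρ hs)
    (symSpan_le_powSpan p (symSum_swap_mem_symSpan (k := k) hp hK hx hy hxy ha))
  rw [← pow_succ, ← pow_succ, mul_sub, ← mul_assoc, ← mul_assoc] at h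
  exact Submodule.mem_sup_right h

theorem swap_left_mem (hp : p.Prime) {r : ℕ} {ρ s : B} (hρ : ρ ∈ powSpan k A p ^ r)
    (hs : s ∈ powSpan k A p) {a : ι → B} {x y : ι} {K : Finset ι}
    (hK : K.card + 1 = p) (hx : x ∉ K) (hy : y ∉ K) (hxy : x ≠ y) (ha : ∀ l, a l ∈ A) :
    ρ * symSum a p (insert x K) * s * a y - ρ * symSum a p (insert y K) * s * a x ∈
      powSpan k A p ⊔ powSpan k A p ^ (r + 2) := by
  have hm {z : ι} (hz : z ∉ K) : symSum a p (insert z K) ∈ powSpan k A p :=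
    symSum_mem_powSpan (by rw [Finset.card_insert_of_notMem hz, hK]) fun l _ => ha l
  have h1 := rotate_mem hp hρ (hm hx) hs (c := a y)
  have h2 := rotate_mem hp hρ (hm hy) hs (c := a x)
  have h3 := Submodule.mul_mem_mul (Submodule.mul_mem_mul hs hρ)
    (symSpan_le_powSpan p (symSum_swap_mem_symSpan (k := k) hp hK hx hy hxy ha))
  rw [← pow_succ', ← pow_succ, mul_sub, ← mul_assoc, ← mul_assoc] at h3
  convert Submodule.sub_mem _ (Submodule.add_mem _ h1 (Submodule.mem_sup_right h3)) h2 using 1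
  abel

theorem exchange_mem (hp : p.Prime) {r : ℕ} {ρ : B} (hρ : ρ ∈ powSpan k A p ^ r) {a : ι → B}
    {x y z : ι} {K L : Finset ι} (hK : K.card + 1 = p) (hL : L.card + 1 = p) (hxK : x ∉ K)
    (hyK : y ∉ K) (hxL : x ∉ L) (hyL : y ∉ L) (hzL : z ∉ L) (hxy : x ≠ y) (hxz : x ≠ z)
    (hyz : y ≠ z) (ha : ∀ l, a l ∈ A) :
    ρ * symSum a p (insert x K) * symSum a p (insert y L) * a z -
      ρ * symSum a p (insert y K) * symSum a p (insert x L) * a z ∈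
      powSpan k A p ⊔ powSpan k A p ^ (r + 2) := by
  have hm {w : ι} {M : Finset ι} (hM : M.card + 1 = p) (hw : w ∉ M) :
      symSum a p (insert w M) ∈ powSpan k A p :=
    symSum_mem_powSpan (by rw [Finset.card_insert_of_notMem hw, hM]) fun l _ => ha l
  have h1 := swap_right_mem hp hρ (hm hK hxK) hL hyL hzL hyz ha
  have h2 := swap_left_mem hp hρ (hm hL hzL) hK hxK hyK hxy ha
  have h3 := swap_right_mem hp hρ (hm hK hyK) hL hzL hxL hxz.symm ha
  convert Submodule.add_mem _ (Submodule.add_mem _ h1 h2) h3 using 1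
  abel

theorem subset_independence_mem (hp : p.Prime) {r : ℕ} {ρ : B} (hρ : ρ ∈ powSpan k A p ^ r)
    {a : ι → B} {t : Finset ι} {z : ι} (ht : t.card = p + p) (hz : z ∉ t) (ha : ∀ l, a l ∈ A)
    {I J : Finset ι} (hI : I ∈ t.powersetCard p) (hJ : J ∈ t.powersetCard p) :
    ρ * symSum a p I * symSum a p (t \ I) * a z - ρ * symSum a p J * symSum a p (t \ J) * a z ∈
      powSpan k A p ⊔ powSpan k A p ^ (r + 2) := by
  induction hn : (J \ I).card generalizing I with
  | zero =>
    rw [Finset.mem_powersetCard] at hI hJ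
    have hJI : J = I := Finset.eq_of_subset_of_card_le
      (Finset.sdiff_eq_empty_iff_subset.mp (Finset.card_eq_zero.mp hn)) (by omega)
    rw [hJI, sub_self]
    exact Submodule.zero_mem _
  | succ n ih =>
    obtain ⟨hIt, hIc⟩ := Finset.mem_powersetCard.mp hI
    obtain ⟨hJt, hJc⟩ := Finset.mem_powersetCard.mp hJ
    obtain ⟨y, hy⟩ := Finset.card_pos.mp (by omega : 0 < (J \ I).card)
    obtain ⟨x, hx⟩ := Finset.card_pos.mp
      (by rw [Finset.card_sdiff_comm (hIc.trans hJc.symm)]; omega : 0 < (I \ J).card)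
    rw [Finset.mem_sdiff] at hx hy
    have hyt := hJt hy.1
    have hxy : x ≠ y := fun h => hy.2 (h ▸ hx.1)
    have hytI : y ∈ t \ I := Finset.mem_sdiff.mpr ⟨hyt, hy.2⟩
    have hcI : (t \ I).card = p := by rw [Finset.card_sdiff_of_subset hIt]; omega
    have hpos := hp.pos
    have hc1 : (I.erase x).card + 1 = p := by rw [Finset.card_erase_of_mem hx.1]; omega
    have hc2 : ((t \ I).erase y).card + 1 = p := by rw [Finset.card_erase_of_mem hytI]; omega
    have h1 := exchange_mem (k := k) hp hρ (a := a) (x := x) (y := y) (z := z) hc1 hc2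
      (Finset.notMem_erase _ _) (fun h => hy.2 (Finset.mem_of_mem_erase h))
      (by simp [hx.1]) (Finset.notMem_erase _ _)
      (fun h => hz (Finset.mem_sdiff.mp (Finset.mem_of_mem_erase h)).1) hxy
      (fun h => hz (h ▸ hIt hx.1)) (fun h => hz (h ▸ hyt)) ha
    have hcompl : insert x ((t \ I).erase y) = t \ insert y (I.erase x) := by
      ext l
      have := @hIt l
      simp only [Finset.mem_insert, Finset.mem_erase, Finset.mem_sdiff]
      rcases eq_or_ne l x with rfl | hlx
      · simp [hxy, hIt hx.1]
      · simp only [hlx, false_or, ne_eq, not_false_eq_true, true_and]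
        tauto
    rw [Finset.insert_erase hx.1, Finset.insert_erase hytI, hcompl] at h1
    have h2 := ih (I := insert y (I.erase x)) (Finset.mem_powersetCard.mpr
      ⟨Finset.insert_subset hyt ((Finset.erase_subset _ _).trans hIt), by
        rw [Finset.card_insert_of_notMem fun h => hy.2 (Finset.mem_of_mem_erase h), hc1]⟩) (by
        have : J \ insert y (I.erase x) = (J \ I).erase y := by
          ext l
          simp only [Finset.mem_insert, Finset.mem_erase, Finset.mem_sdiff]
          rcases eq_or_ne l x with rfl | hlx
          · simp [hx.2]
          · tauto
        rw [this, Finset.card_erase_of_mem (Finset.mem_sdiff.mpr hy), hn]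
        rfl)
    simpa using Submodule.add_mem _ h1 h2

theorem choose_add_self_ne_zero (hp : p.Prime) (hp2 : 2 < p) : ((p + p).choose p : k) ≠ 0 := by
  have : Fact p.Prime := ⟨hp⟩
  have h := @Choose.choose_modEq_choose_mod_mul_choose_div_nat (p + p) p p _
  rw [Nat.add_mod_right, Nat.mod_self, Nat.add_div_right _ hp.pos, Nat.div_self hp.pos] at h
  rw [Ne, CharP.cast_eq_zero_iff k p, h.dvd_iff dvd_rfl]
  exact Nat.not_dvd_of_pos_of_lt two_pos hp2

theorem mul_symSum_mul_symSum_mul_mem (hp : p.Prime) (hp2 : 2 < p) {r : ℕ} {ρ : B}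
    (hρ : ρ ∈ powSpan k A p ^ r) {a : ι → B} {t : Finset ι} {z : ι} (ht : t.card = p + p)
    (hz : z ∉ t) (ha : ∀ l, a l ∈ A) (haz : a z ∈ powSpan k A p) {J : Finset ι}
    (hJ : J ∈ t.powersetCard p) :
    ρ * symSum a p J * symSum a p (t \ J) * a z ∈ powSpan k A p ⊔ powSpan k A p ^ (r + 2) := by
  have h1 := Submodule.sum_mem _ fun I (hI : I ∈ t.powersetCard p) =>
    subset_independence_mem (k := k) hp hρ ht hz ha hI hJ
  have h2 : ∑ I ∈ t.powersetCard p, ρ * symSum a p I * symSum a p (t \ I) * a z =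
      ρ * symSum a (p + p) t * a z := by
    rw [← symSum_add, Finset.mul_sum, Finset.sum_mul]
    simp only [mul_assoc]
  have h3 : ρ * symSum a (p + p) t * a z ∈ powSpan k A p ^ (r + 2) := by
    rw [pow_succ, pow_succ]
    exact Submodule.mul_mem_mul (Submodule.mul_mem_mul hρ (powSpan_add_self_le p
      (symSum_mem_powSpan ht fun l _ => ha l))) haz
  rw [Finset.sum_sub_distrib, h2, Finset.sum_const, Finset.card_powersetCard, ht,
    ← Nat.cast_smul_eq_nsmul k] at h1
  have h4 := Submodule.sub_mem _ (Submodule.mem_sup_right h3) h1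
  rw [sub_sub_cancel] at h4
  exact (Submodule.smul_mem_iff _ (choose_add_self_ne_zero hp hp2)).mp h4

theorem mul_symSpan_mul_symSpan_mul_le (hp : p.Prime) (hp2 : 2 < p) (r : ℕ) :
    powSpan k A p ^ r * (symSpan k A p * symSpan k A p) * powSpan k A p ≤
      powSpan k A p ⊔ powSpan k A p ^ (r + 2) := by
  conv_lhs => rw [symSpan, Submodule.span_mul_span]
  refine Submodule.mul_le.mpr fun x hx h hh => ?_
  induction hx using Submodule.mul_induction_on' with
  | add x _ y _ h1 h2 =>
    rw [add_mul]
    exact Submodule.add_mem _ h1 h2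
  | mem_mul_mem ρ hρ u hu =>
    induction hu using Submodule.span_induction with
    | zero => simp
    | add x y _ _ h1 h2 =>
      rw [mul_add, add_mul]
      exact Submodule.add_mem _ h1 h2
    | smul c x _ h1 =>
      rw [mul_smul_comm, smul_mul_assoc]
      exact Submodule.smul_mem _ c h1
    | mem u hu =>
      obtain ⟨_, ⟨a, ha, rfl⟩, _, ⟨b, hb, rfl⟩, rfl⟩ := hu
      let c : Option (Fin p ⊕ Fin p) → B := fun l => l.elim h (Sum.elim a b)
      have hc : ∀ l, c l ∈ A := by
        rintro (_ | i | i)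
        exacts [mem_of_mem_powSpan hp.ne_zero hh, ha i, hb i]
      let e₁ : Fin p ↪ Option (Fin p ⊕ Fin p) := Function.Embedding.inl.trans .some
      let e₂ : Fin p ↪ Option (Fin p ⊕ Fin p) := Function.Embedding.inr.trans .some
      have hdiff : Finset.univ.map Function.Embedding.some \ Finset.univ.map e₁ =
          Finset.univ.map e₂ := by
        ext (_ | i | i) <;> simp [e₁, e₂]
      have := mul_symSum_mul_symSum_mul_mem (k := k) hp hp2 hρ (a := c)
        (t := Finset.univ.map Function.Embedding.some) (z := none) (J := Finset.univ.map e₁)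
        (by simp) (by simp) hc hh (by
          rw [Finset.mem_powersetCard]
          exact ⟨fun l => by rcases l with _ | i | i <;> simp [e₁], by simp⟩)
      rwa [hdiff, symSum_map, symSum_map, mul_assoc ρ] at this

theorem powSpan_pow_succ_le_sup (hp : p.Prime) (hp2 : 2 < p) {n : ℕ} (hn : 2 ≤ n) :
    powSpan k A p ^ (n + 1) ≤ powSpan k A p ⊔ powSpan k A p ^ n := by
  refine (powSpan_pow_succ_le hp hp2 (by omega)).trans (sup_le le_sup_right ?_)
  obtain ⟨r, rfl⟩ := Nat.exists_eq_add_of_le' hn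
  refine le_trans ?_ (mul_symSpan_mul_symSpan_mul_le hp hp2 r)
  rw [pow_add, pow_two]
  exact mul_le_mul_left (mul_le_mul_left (pow_le_pow_left' (symSpan_le_powSpan p) r) _) _

theorem powSpan_pow_le_sup (hp : p.Prime) (hp2 : 2 < p) {n N : ℕ} (hn : 2 ≤ n) (hN : n ≤ N) :
    powSpan k A p ^ N ≤ powSpan k A p ⊔ powSpan k A p ^ n := by
  induction N, hN using Nat.le_induction with
  | base => exact le_sup_right
  | succ N hN ih =>
    exact (powSpan_pow_succ_le_sup hp hp2 (hn.trans hN)).trans (sup_le le_sup_left ih)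

end Prime

end Spans

section FreeAlgebra

theorem map_npow' {A B F : Type*} [NonUnitalSemiring A] [Semiring B] [FunLike F A B]
    [MulHomClass F A B] (φ : F) (a : A) {n : ℕ} (hn : n ≠ 0) : φ (npow' a n) = φ a ^ n := by
  obtain ⟨n, rfl⟩ := Nat.exists_eq_succ_of_ne_zero hn
  induction n with
  | zero => simp [npow', lprod]
  | succ n ih =>
    rw [pow_succ', ← ih n.succ_ne_zero, ← map_mul]
    rfl

variable (k : Type*) [Field k]

theorem isTSpace_TSpan (S : Set (FA k)) : IsTSpace k (TSpan k S) := by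
  intro φ v hv
  induction hv using Submodule.span_induction with
  | mem x hx =>
    obtain ⟨ψ, s, hs, rfl⟩ := hx
    exact Submodule.subset_span ⟨φ.comp ψ, s, hs, rfl⟩
  | zero => simp
  | add x y _ _ h1 h2 =>
    rw [map_add]
    exact Submodule.add_mem _ h1 h2
  | smul c x _ h1 =>
    rw [map_smul]
    exact Submodule.smul_mem _ c h1

theorem isTSpace_Hn (p n : ℕ) : IsTSpace k (Hn k p n) := by
  rcases n with _ | _ | n
  · intro φ v hv
    rw [Hn, Submodule.mem_bot] at hv ⊢
    rw [hv, map_zero]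
  · rw [Hn]
    exact isTSpace_TSpan k _
  · rw [Hn]
    exact isTSpace_TSpan k _

theorem TSpan_mulSet {U V : Submodule k (FA k)} (hU : IsTSpace k U) (hV : IsTSpace k V) :
    TSpan k (mulSet U V) = Submodule.span k (mulSet U V) := by
  refine le_antisymm (Submodule.span_mono ?_) (Submodule.span_mono fun x hx => ?_)
  · rintro _ ⟨φ, _, ⟨u, hu, v, hv, rfl⟩, rfl⟩
    exact ⟨φ u, hU φ u hu, φ v, hV φ v hv, map_mul φ u v⟩
  · exact ⟨NonUnitalAlgHom.id k (FA k), x, hx, rfl⟩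

theorem map_span_mulSet {B : Type*} [Ring B] [Algebra k B] (φ : FA k →ₙₐ[k] B)
    (U V : Submodule k (FA k)) :
    (Submodule.span k (mulSet U V)).map (φ : FA k →ₗ[k] B) =
      U.map (φ : FA k →ₗ[k] B) * V.map (φ : FA k →ₗ[k] B) := by
  rw [Submodule.map_span]
  refine le_antisymm (Submodule.span_le.mpr ?_) (Submodule.mul_le.mpr ?_)
  · rintro _ ⟨_, ⟨u, hu, v, hv, rfl⟩, rfl⟩
    exact Set.mem_of_eq_of_mem (map_mul φ u v) (Submodule.mul_mem_mul ⟨u, hu, rfl⟩ ⟨v, hv, rfl⟩)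
  · rintro _ ⟨u, hu, rfl⟩ _ ⟨v, hv, rfl⟩
    exact Submodule.subset_span ⟨u * v, ⟨u, hu, v, hv, rfl⟩, map_mul φ u v⟩

theorem exists_map_Xg_eq (a : FA k) : ∃ φ : FA k →ₙₐ[k] FA k, φ (Xg k 0) = a := by
  refine ⟨MonoidAlgebra.liftMagma k (FreeSemigroup.lift fun _ => a), ?_⟩
  simp [Xg, MonoidAlgebra.liftMagma]

/-- The free non-unital algebra as a linear subspace of its unitization. -/
noncomputable abbrev inrUnitization : FA k →ₙₐ[k] Unitization k (FA k) :=
  Unitization.inrNonUnitalAlgHom k (FA k)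

/-- The free non-unital algebra as an ideal of its unitization. -/
noncomputable abbrev augIdeal : Ideal (Unitization k (FA k)) :=
  RingHom.ker (Unitization.fstHom k (FA k))

theorem mem_augIdeal {x : Unitization k (FA k)} : x ∈ augIdeal k ↔ ∃ a, inrUnitization k a = x := by
  rw [RingHom.mem_ker]
  constructor
  · intro h
    exact ⟨x.snd, Unitization.ext (by simpa using h.symm) (by simp)⟩
  · rintro ⟨a, rfl⟩
    simp

theorem map_Hn_one {p : ℕ} (hp : p ≠ 0) :
    (Hn k p 1).map (inrUnitization k : FA k →ₗ[k] Unitization k (FA k)) =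
      powSpan k (augIdeal k) p := by
  rw [Hn, TSpan, Submodule.map_span, powSpan]
  congr 1
  ext x
  constructor
  · rintro ⟨_, ⟨φ, _, rfl, rfl⟩, rfl⟩
    exact ⟨inrUnitization k (φ (Xg k 0)), (mem_augIdeal k).mpr ⟨_, rfl⟩,
      (map_npow' ((inrUnitization k).comp φ) (Xg k 0) hp).symm⟩
  · rintro ⟨y, hy, rfl⟩
    obtain ⟨a, rfl⟩ := (mem_augIdeal k).mp hy
    obtain ⟨φ, rfl⟩ := exists_map_Xg_eq k a
    exact ⟨_, ⟨φ, _, rfl, rfl⟩, map_npow' ((inrUnitization k).comp φ) (Xg k 0) hp⟩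

theorem map_Hn {p : ℕ} (hp : p ≠ 0) {n : ℕ} (hn : n ≠ 0) :
    (Hn k p n).map (inrUnitization k : FA k →ₗ[k] Unitization k (FA k)) =
      powSpan k (augIdeal k) p ^ n := by
  obtain ⟨n, rfl⟩ := Nat.exists_eq_succ_of_ne_zero hn
  induction n with
  | zero => rw [Nat.succ_eq_add_one, pow_one, map_Hn_one k hp]
  | succ n ih =>
    rw [Nat.succ_eq_add_one, pow_succ, ← ih n.succ_ne_zero, ← map_Hn_one k hp, Hn.eq_3,
      TSpan_mulSet k (isTSpace_Hn k p _) (isTSpace_Hn k p _)]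
    exact map_span_mulSet k (inrUnitization k) _ _

end FreeAlgebra

/-- For `p > 2`: `H_{2m+1} ⊆ H_1 + H_{m+1}` for every `m ≥ 1`. -/
theorem h_result (k : Type*) [Field k] (p : ℕ) (hp : p.Prime) (hp2 : 2 < p)
    [CharP k p] :
    ∀ m : ℕ, 1 ≤ m → Hn k p (2 * m + 1) ≤ Hn k p 1 ⊔ Hn k p (m + 1) := by
  intro m hm
  have hinj : Function.Injective (inrUnitization k : FA k →ₗ[k] Unitization k (FA k)) :=
    Unitization.inr_injective
  rw [← Submodule.map_le_map_iff_of_injective hinj, Submodule.map_sup, map_Hn_one k hp.ne_zero,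
    map_Hn k hp.ne_zero (by omega), map_Hn k hp.ne_zero (by omega)]
  exact powSpan_pow_le_sup hp hp2 (by omega) (by omega)
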